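/- Fix ρ ∈ [0,1]. For odd n, let Maj_n : {−1,1}ⁿ → {−1,1} be the majority function Maj_n(x) = sign(x₁ + x₂ + ⋯ + x_n). Then the noise stability of majority converges: the limit as n → ∞ (over odd n) of S_ρ(Maj_n) equals (2/π)·arcsin(ρ). -/

import Mathlib

open Finset

/-- Noise stability of `f` at correlation `ρ`: the expectation of `f x * f y` over a
`ρ`-correlated pair `(x, y)`; `x` is uniform and each bit of `y` equals the corresponding
bit of `x` with probability `(1+ρ)/2`, independently. -/
noncomputable def noiseStability (n : ℕ) (ρ : ℝ) (f : (Fin n → Bool) → ℝ) : ℝ :=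
  (∑ x : Fin n → Bool, ∑ y : Fin n → Bool,
    f x * f y * ∏ i : Fin n, (if x i = y i then (1 + ρ) / 2 else (1 - ρ) / 2)) / 2 ^ n

/-- The (±1-valued) majority function on `n` bits: the sign of `x₁ + ⋯ + xₙ`, where the
bit `b` is interpreted as `1` if `b = true` and `-1` otherwise. -/
noncomputable def majorityF (n : ℕ) (x : Fin n → Bool) : ℝ :=
  if 0 < ∑ i : Fin n, (if x i then (1 : ℝ) else -1) then 1 else -1


noncomputable def uu (m : ℕ) : ℝ := ∏ i ∈ range m, ((2 * i + 1 : ℝ) / (2 * i + 2))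

lemma uu_succ (m : ℕ) : uu (m + 1) = uu m * ((2 * m + 1 : ℝ) / (2 * m + 2)) := prod_range_succ _ _

lemma uu_nonneg (m : ℕ) : 0 ≤ uu m := prod_nonneg fun i _ => by positivity

lemma uu_le_one (m : ℕ) : uu m ≤ 1 := by
  refine prod_le_one (fun i _ => by positivity) fun i _ => ?_
  rw [div_le_one (by positivity)]; linarith

lemma uu_choose (m : ℕ) : Ring.choose ((1 / 2 : ℝ) + m - 1) m = uu m := by
  have h : ∀ m : ℕ, Ring.multichoose (1 / 2 : ℝ) m = uu m := by
    intro m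
    have h1 : ∀ m : ℕ, (m.factorial : ℝ) * Ring.multichoose (1 / 2 : ℝ) m
        = (ascPochhammer ℝ m).eval (1 / 2 : ℝ) := by
      intro m
      have := Ring.factorial_nsmul_multichoose_eq_ascPochhammer (1 / 2 : ℝ) m
      rw [Polynomial.ascPochhammer_smeval_eq_eval, nsmul_eq_mul] at this
      exact this
    induction m with
    | zero => simp [uu]
    | succ m ih =>
      have a := h1 (m + 1)
      have b := h1 m
      rw [ascPochhammer_succ_eval, ← b, ih, Nat.factorial_succ] at a
      push_cast at a
      have : (m.factorial : ℝ) ≠ 0 := by positivity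
      rw [uu_succ]
      have h3 : (m.factorial : ℝ) * ((m + 1) * Ring.multichoose (1 / 2 : ℝ) (m + 1)) =
        m.factorial * (uu m * (1 / 2 + m)) := by linarith
      have h4 := mul_left_cancel₀ this h3
      field_simp
      linarith
  rw [← h, Ring.multichoose_eq]

lemma uu_hasSum {y : ℝ} (hy : |y| < 1) : HasSum (fun m => uu m * y ^ (2 * m)) (1 / √(1 - y ^ 2)) := by
  have hy2 : y ^ 2 < 1 := (sq_lt_one_iff_abs_lt_one y).2 hy
  have := (Real.one_div_one_sub_rpow_hasFPowerSeriesOnBall_zero (1 / 2)).hasSum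
    (y := y ^ 2) (by simp [Metric.mem_eball, edist_dist, hy2])
  simp only [FormalMultilinearSeries.ofScalars_apply_eq, uu_choose, zero_add, smul_eq_mul, ← pow_mul, ← Real.sqrt_eq_rpow] at this
  exact this

lemma arcsin_hasSum {x : ℝ} (hx0 : 0 ≤ x) (hx : x < 1) :
    ∑' m, uu m / (2 * m + 1) * x ^ (2 * m + 1) = Real.arcsin x := by
  obtain ⟨r, hxr, hr1⟩ := exists_between hx
  have hr0 : 0 < r := hx0.trans_lt hxr
  have hd : ∀ y ∈ Set.Ioo (-r) r,
      HasDerivAt (fun z : ℝ => ∑' m : ℕ, uu m / (2 * m + 1) * z ^ (2 * m + 1)) (1 / √(1 - y ^ 2)) y := by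
    intro y hy
    have hay : |y| < r := abs_lt.2 hy
    rw [← (uu_hasSum (hay.trans hr1)).tsum_eq]
    refine hasDerivAt_tsum_of_isPreconnected (F := ℝ) (g := fun (m : ℕ) (z : ℝ) => uu m / (2 * m + 1) * z ^ (2 * m + 1)) (g' := fun (m : ℕ) (z : ℝ) => uu m * z ^ (2 * m)) (u := fun m => r ^ (2 * m)) (t := Set.Ioo (-r) r)
      (y₀ := 0) ?_ isOpen_Ioo isPreconnected_Ioo ?_ ?_ (by simpa using hr0) ?_ hy
    · simp_rw [pow_mul]
      exact summable_geometric_of_lt_one (by positivity) (by nlinarith)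
    · intro n z hz
      have := (hasDerivAt_pow (2 * n + 1) z).const_mul (uu n / (2 * n + 1))
      convert! this using 1
      rw [add_tsub_cancel_right]
      push_cast
      field_simp
    · intro n z hz
      rw [norm_mul, norm_pow, Real.norm_eq_abs, Real.norm_eq_abs, abs_of_nonneg (uu_nonneg n)]
      have := pow_le_pow_left₀ (abs_nonneg z) (abs_lt.2 hz).le (2 * n)
      have h2 : 0 ≤ |z| ^ (2 * n) := by positivity
      nlinarith [uu_le_one n, uu_nonneg n]
    · simp [summable_zero]
  have hd2 : ∀ y ∈ Set.Ioo (-r) r, HasDerivAt Real.arcsin (1 / √(1 - y ^ 2)) y := fun y hy =>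
    Real.hasDerivAt_arcsin (by linarith [hy.1]) (by linarith [hy.2])
  have := isOpen_Ioo.eqOn_of_deriv_eq (s := Set.Ioo (-r) r) (x := 0) isPreconnected_Ioo
    (fun y hy => (hd y hy).differentiableAt.differentiableWithinAt)
    (fun y hy => (hd2 y hy).differentiableAt.differentiableWithinAt)
    (fun y hy => by rw [(hd y hy).deriv, (hd2 y hy).deriv]) (by simpa using hr0) (by simp)
  exact this ⟨by linarith, hxr⟩

open Polynomial in
noncomputable def cc (k m : ℕ) : ℝ := (((X - 1) ^ (2 * m) * (X + 1) ^ (2 * k - 2 * m) : ℝ[X])).coeff k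

open Polynomial in
lemma coeff_rec (p q N : ℕ) (h : p + q + 2 = 2 * N) :
    (p + 1 : ℝ) * ((X - 1) ^ p * (X + 1) ^ (q + 2) : ℝ[X]).coeff N
      + (q + 1) * ((X - 1) ^ (p + 2) * (X + 1) ^ q : ℝ[X]).coeff N = 0 := by
  have hN : (p : ℝ) + q + 2 = 2 * N := by exact_mod_cast h
  set G : ℝ[X] := (X - 1) ^ (p + 1) * (X + 1) ^ (q + 1) with hG
  have h1 : (X * derivative G).coeff N = N * G.coeff N := by
    cases N with
    | zero => simp
    | succ N => rw [coeff_X_mul, coeff_derivative]; push_cast; ring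
  have hC : (C (p : ℝ) + C (q : ℝ) + 2 : ℝ[X]) = 2 * C (N : ℝ) := by
    have := congrArg (C : ℝ → ℝ[X]) hN
    simp only [C_add, C_mul] at this
    exact this
  have h2 : C (p + 1 : ℝ) * ((X - 1) ^ p * (X + 1) ^ (q + 2) : ℝ[X])
      + C (q + 1 : ℝ) * ((X - 1) ^ (p + 2) * (X + 1) ^ q : ℝ[X])
      = 2 * (X * derivative G) - 2 * C (N : ℝ) * G := by
    rw [← hC, hG]
    simp only [derivative_mul, derivative_pow, derivative_sub, derivative_add, derivative_X, derivative_one, C_add, C_1, add_tsub_cancel_right, Nat.cast_add, Nat.cast_one]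
    ring
  have h3 := congrArg (fun P => coeff P N) h2
  have e : (2 * (X * derivative G) - 2 * C (N : ℝ) * G : ℝ[X]) = C 2 * (X * derivative G) - C (2 * N : ℝ) * G := by
    rw [C_mul]; rfl
  simp only [e, coeff_add, coeff_sub, coeff_C_mul, h1] at h3
  rw [h3]; ring

lemma cc_rec (k m : ℕ) (h : m < k) :
    (2 * m + 1 : ℝ) * cc k m + (2 * k - 2 * m - 1) * cc k (m + 1) = 0 := by
  have := coeff_rec (2 * m) (2 * k - 2 * m - 2) k (by omega)
  rw [show 2 * k - 2 * m - 2 + 2 = 2 * k - 2 * m by omega] at this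
  unfold cc
  rw [show 2 * (m + 1) = 2 * m + 2 by ring, show 2 * k - (2 * m + 2) = 2 * k - 2 * m - 2 by omega]
  have e : ((2 * k - 2 * m - 2 : ℕ) : ℝ) = 2 * k - 2 * m - 2 := by
    rw [Nat.cast_sub (by omega), Nat.cast_sub (by omega)]; push_cast; ring
  rw [e] at this
  push_cast at this
  linarith

noncomputable def WW (k m : ℕ) : ℝ := ((2 * k + 1).choose (2 * m + 1) : ℝ) * (cc k m) ^ 2 / 16 ^ k

lemma WW_nonneg (k m : ℕ) : 0 ≤ WW k m := by unfold WW; positivity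

lemma WW_rec (k m : ℕ) (h : m < k) :
    WW k (m + 1) = WW k m * ((2 * m + 1) ^ 2 / ((2 * m + 2) * (2 * m + 3))
      * (1 + 1 / (2 * k - 2 * m - 1))) := by
  have h1 := cc_rec k m h
  have hk : (m : ℝ) + 1 ≤ k := by exact_mod_cast h
  have hp : (2 * k - 2 * m - 1 : ℝ) ≠ 0 := by linarith
  have h2 : cc k (m + 1) = - ((2 * m + 1) * cc k m) / (2 * k - 2 * m - 1) := by
    rw [eq_div_iff hp]; linarith
  have a := Nat.choose_succ_right_eq (2 * k + 1) (2 * m + 1)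
  have b := Nat.choose_succ_right_eq (2 * k + 1) (2 * m + 2)
  have a' : ((2 * k + 1).choose (2 * m + 2) : ℝ) * (2 * m + 2) = (2 * k + 1).choose (2 * m + 1) * (2 * k - 2 * m) := by
    have := congrArg (Nat.cast : ℕ → ℝ) a
    rw [Nat.cast_mul, Nat.cast_mul, Nat.cast_sub (by omega)] at this
    push_cast at this
    linarith
  have b' : ((2 * k + 1).choose (2 * m + 3) : ℝ) * (2 * m + 3) = (2 * k + 1).choose (2 * m + 2) * (2 * k - 2 * m - 1) := by
    have := congrArg (Nat.cast : ℕ → ℝ) b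
    rw [Nat.cast_mul, Nat.cast_mul, Nat.cast_sub (by omega)] at this
    push_cast at this
    linarith
  have a2 : ((2 * k + 1).choose (2 * m + 2) : ℝ) = (2 * k + 1).choose (2 * m + 1) * (2 * k - 2 * m) / (2 * m + 2) := by
    rw [eq_div_iff (by positivity)]; exact a'
  have b2 : ((2 * k + 1).choose (2 * m + 3) : ℝ) = (2 * k + 1).choose (2 * m + 2) * (2 * k - 2 * m - 1) / (2 * m + 3) := by
    rw [eq_div_iff (by positivity)]; exact b'
  unfold WW
  rw [show 2 * (m + 1) + 1 = 2 * m + 3 by ring, h2, b2, a2]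
  obtain ⟨D, hD⟩ : ∃ D : ℝ, D = 2 * k - 2 * m - 1 := ⟨_, rfl⟩
  have hD' : (2 * k - 2 * m : ℝ) = D + 1 := by linarith
  rw [← hD] at hp ⊢
  rw [hD']
  field_simp

open Polynomial in
lemma WW_zero (k : ℕ) : WW k 0 = (Real.Wallis.W k)⁻¹ := by
  have : cc k 0 = ((2 * k).choose k : ℝ) := by
    simp [cc, coeff_X_add_one_pow]
  rw [WW, this, Real.Wallis.W_eq_factorial_ratio]
  have h := Nat.add_choose_mul_factorial_mul_factorial k k
  rw [← two_mul] at h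
  rw [← h]
  push_cast
  have : (16 : ℝ) ^ k = 2 ^ (4 * k) := by rw [pow_mul]; norm_num
  rw [this]
  have : (k.factorial : ℝ) ≠ 0 := by positivity
  simp
  field_simp

open Filter in
lemma WW_tendsto (A : ℕ → ℝ) (h0 : A 0 = 1)
    (hA : ∀ m : ℕ, A (m + 1) = A m * ((2 * m + 1) ^ 2 / ((2 * m + 2) * (2 * m + 3)))) (m : ℕ) :
    Tendsto (fun k => WW k m) atTop (nhds (2 / Real.pi * A m)) := by
  induction m with
  | zero =>
    simp_rw [WW_zero]
    have := Real.Wallis.tendsto_W_nhds_pi_div_two.inv₀ (by positivity)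
    simpa [h0] using this
  | succ m ih =>
    have h1 : Tendsto (fun k : ℕ => (1 : ℝ) + 1 / (2 * k - 2 * m - 1)) atTop (nhds (1 + 0)) := by
      refine tendsto_const_nhds.add (tendsto_const_nhds.div_atTop ?_)
      have : Tendsto (fun k : ℕ => (2 : ℝ) * k + (- 2 * m - 1)) atTop atTop :=
        tendsto_atTop_add_const_right _ _ (tendsto_natCast_atTop_atTop.const_mul_atTop two_pos)
      exact this.congr fun k => by ring
    have h2 := ih.mul (h1.const_mul ((2 * m + 1 : ℝ) ^ 2 / ((2 * m + 2) * (2 * m + 3))))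
    rw [hA, ← mul_assoc]
    simp only [add_zero, mul_one] at h2
    refine h2.congr' ?_
    filter_upwards [eventually_gt_atTop m] with k hk
    rw [WW_rec k m hk]

noncomputable def sg (b : Bool) : ℝ := if b then 1 else -1

noncomputable def FF (n : ℕ) (f : (Fin n → Bool) → ℝ) (S : Finset (Fin n)) : ℝ :=
  ∑ x : Fin n → Bool, f x * ∏ i ∈ S, sg (x i)

lemma stab_fourier (n : ℕ) (ρ : ℝ) (f : (Fin n → Bool) → ℝ) :
    noiseStability n ρ f = (∑ S ∈ (univ : Finset (Fin n)).powerset, ρ ^ S.card * FF n f S ^ 2) / 4 ^ n := by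
  have h1 : ∀ x y : Fin n → Bool, ∏ i : Fin n, (if x i = y i then (1 + ρ) / 2 else (1 - ρ) / 2)
      = (∑ S ∈ (univ : Finset (Fin n)).powerset, ρ ^ S.card * ((∏ i ∈ S, sg (x i)) * ∏ i ∈ S, sg (y i))) / 2 ^ n := by
    intro x y
    have : ∀ i, (if x i = y i then (1 + ρ) / 2 else (1 - ρ) / 2) = (1 + ρ * (sg (x i) * sg (y i))) / 2 := by
      intro i
      cases x i <;> cases y i <;> simp [sg] <;> ring
    simp_rw [this]
    rw [prod_div_distrib, prod_one_add]
    simp [prod_mul_distrib]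
  unfold noiseStability
  have h4 : (4 : ℝ) ^ n = 2 ^ n * 2 ^ n := by rw [← mul_pow]; norm_num
  simp_rw [h1]
  rw [h4, ← div_div]
  congr 1
  have h5 : ∀ S, ρ ^ S.card * FF n f S ^ 2 = ∑ x : Fin n → Bool, ∑ y : Fin n → Bool,
     f x * f y * (ρ ^ S.card * ((∏ i ∈ S, sg (x i)) * ∏ i ∈ S, sg (y i))) := by
    intro S
    rw [FF, sq, sum_mul_sum, mul_sum]
    refine sum_congr rfl fun x _ => ?_
    rw [mul_sum]
    refine sum_congr rfl fun y _ => ?_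
    ring
  simp_rw [h5]
  symm
  rw [sum_comm, sum_div]
  refine sum_congr rfl fun x _ => ?_
  rw [sum_comm, sum_div]
  refine sum_congr rfl fun y _ => ?_
  rw [← mul_sum, mul_div_assoc]

def cnt {n : ℕ} (x : Fin n → Bool) : ℕ := ∑ i, if x i then 1 else 0

lemma cnt_le {n : ℕ} (x : Fin n → Bool) : cnt x ≤ n := by
  calc cnt x ≤ ∑ i : Fin n, 1 := sum_le_sum fun i _ => by split_ifs <;> simp
    _ = n := by simp

lemma sum_cnt {n : ℕ} (x : Fin n → Bool) : ∑ i : Fin n, (if x i then (1 : ℝ) else -1) = 2 * cnt x - n := by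
  have : ∀ i, (if x i then (1 : ℝ) else -1) = 2 * (if x i then 1 else 0) - 1 := by
    intro i; split_ifs <;> norm_num
  simp_rw [this]
  rw [sum_sub_distrib, ← mul_sum]
  simp [cnt]

noncomputable def phi (k j : ℕ) : ℝ := if k < j then 1 else -1

lemma maj_eq (k : ℕ) (x : Fin (2 * k + 1) → Bool) : majorityF (2 * k + 1) x = phi k (cnt x) := by
  unfold majorityF phi
  rw [sum_cnt]
  congr 1
  rw [eq_iff_iff]
  constructor
  · intro h
    push_cast at h
    have : (2 * k + 1 : ℝ) < 2 * cnt x := by linarith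
    have : 2 * k + 1 < 2 * cnt x := by exact_mod_cast this
    omega
  · intro h
    have : 2 * k + 1 < 2 * cnt x := by omega
    have : (2 * k + 1 : ℝ) < 2 * cnt x := by exact_mod_cast this
    push_cast
    linarith

lemma maj_not (k : ℕ) (x : Fin (2 * k + 1) → Bool) :
    majorityF (2 * k + 1) (fun i => !(x i)) = - majorityF (2 * k + 1) x := by
  rw [maj_eq, maj_eq]
  have : cnt (fun i => !(x i)) + cnt x = 2 * k + 1 := by
    unfold cnt
    rw [← sum_add_distrib]
    have : ∀ i, ((if (!(x i)) = true then 1 else 0) + if x i = true then 1 else 0) = 1 := by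
      intro i; cases x i <;> simp
    simp_rw [this]; simp
  unfold phi
  split_ifs <;> first | omega | norm_num

lemma FF_even (k : ℕ) (S : Finset (Fin (2 * k + 1))) (h : Even S.card) :
    FF _ (majorityF (2 * k + 1)) S = 0 := by
  have e : FF _ (majorityF (2 * k + 1)) S = - FF _ (majorityF (2 * k + 1)) S := by
    conv_lhs => unfold FF
    rw [FF, ← sum_neg_distrib]
    let e : (Fin (2 * k + 1) → Bool) ≃ (Fin (2 * k + 1) → Bool) := Equiv.piCongrRight fun _ => Equiv.boolNot
    rw [← Equiv.sum_comp e]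
    refine sum_congr rfl fun x _ => ?_
    have : e x = fun i => !(x i) := by ext i; simp [e]
    rw [this, maj_not]
    have : ∀ i, sg (!(x i)) = - sg (x i) := by intro i; cases x i <;> simp [sg]
    simp_rw [this, prod_neg]
    rw [h.neg_one_pow]; ring
  linarith

open Polynomial in
lemma gen_poly (n : ℕ) (S : Finset (Fin n)) :
    ((X - 1) ^ S.card * (X + 1) ^ (n - S.card) : ℝ[X]) =
      ∑ x : Fin n → Bool, C (∏ i ∈ S, sg (x i)) * X ^ cnt x := by
  have h1 : ((X - 1) ^ S.card * (X + 1) ^ (n - S.card) : ℝ[X]) =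
      ∏ i : Fin n, ∑ b : Bool, (if i ∈ S then C (sg b) else 1) * X ^ (if b then 1 else 0) := by
    have : ∀ i : Fin n, ∑ b : Bool, (if i ∈ S then C (sg b) else 1) * X ^ (if b then 1 else 0)
        = (if i ∈ S then (X - 1 : ℝ[X]) else X + 1) := by
      intro i; split_ifs <;> simp [sg]; ring
    simp_rw [this]
    rw [prod_ite]
    simp [filter_not, card_sdiff]
  rw [h1, prod_univ_sum]
  simp only [Fintype.piFinset_univ]
  refine sum_congr rfl fun x _ => ?_
  rw [prod_mul_distrib, prod_pow_eq_pow_sum, cnt, prod_ite_mem, univ_inter, map_prod]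

open Polynomial in
lemma FF_coeff (k : ℕ) (S : Finset (Fin (2 * k + 1))) :
    FF _ (majorityF (2 * k + 1)) S = ∑ j ∈ range (2 * k + 2),
      phi k j * ((X - 1) ^ S.card * (X + 1) ^ (2 * k + 1 - S.card) : ℝ[X]).coeff j := by
  rw [gen_poly]
  simp_rw [finsetSum_coeff, mul_sum]
  rw [sum_comm, FF]
  refine sum_congr rfl fun x _ => ?_
  simp only [coeff_C_mul, coeff_X_pow]
  rw [sum_eq_single (cnt x)]
  · rw [maj_eq]; simp
  · intro j _ hj; simp [hj]
  · intro h; exact absurd (mem_range.2 (by have := cnt_le x; omega)) h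

open Polynomial in
lemma tele (Q : ℝ[X]) (k : ℕ) (hQ : Q.coeff (2 * k + 1) = 0) :
    ∑ j ∈ range (2 * k + 2), phi k j * ((X - 1) * Q).coeff j = 2 * Q.coeff k := by
  have h1 : ∀ N, ∑ j ∈ range (N + 1), ((X - 1) * Q).coeff j = - Q.coeff N := by
    intro N
    induction N with
    | zero => simp [sub_mul]
    | succ N ih => rw [sum_range_succ, ih, sub_mul, coeff_sub, coeff_X_mul, one_mul]; ring
  have h2 : ∀ j, phi k j = 1 - 2 * (if j < k + 1 then 1 else 0) := by
    intro j; unfold phi; split_ifs <;> first | omega | norm_num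
  have h3 : ∑ j ∈ range (2 * k + 2), phi k j * ((X - 1) * Q).coeff j
     = ∑ j ∈ range (2 * k + 1 + 1), ((X - 1) * Q).coeff j - 2 * ∑ j ∈ range (k + 1), ((X - 1) * Q).coeff j := by
    have : range (k + 1) = (range (2 * k + 2)).filter (· < k + 1) := by
      ext j; simp; omega
    rw [this, sum_filter, mul_sum, ← sum_sub_distrib]
    refine sum_congr rfl fun j _ => ?_
    rw [h2]; split_ifs <;> ring
  rw [h3, h1, h1, hQ]; ring

open Polynomial in
lemma FF_odd (k m : ℕ) (S : Finset (Fin (2 * k + 1))) (h : S.card = 2 * m + 1) :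
    FF _ (majorityF (2 * k + 1)) S = 2 * cc k m := by
  have hle : S.card ≤ 2 * k + 1 := by simpa using card_le_univ S
  rw [FF_coeff, h, pow_succ', show 2 * k + 1 - (2 * m + 1) = 2 * k - 2 * m by omega, cc]
  simp_rw [mul_assoc]
  refine tele _ k (coeff_eq_zero_of_natDegree_lt ?_)
  have h1 : ((X - 1 : ℝ[X]) ^ (2 * m)).natDegree ≤ 2 * m := by
    refine (natDegree_pow_le).trans ?_
    have : (X - 1 : ℝ[X]).natDegree = 1 := natDegree_X_sub_C 1
    rw [this]; simp
  have h2 : ((X + 1 : ℝ[X]) ^ (2 * k - 2 * m)).natDegree ≤ 2 * k - 2 * m := by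
    refine (natDegree_pow_le).trans ?_
    have : (X + 1 : ℝ[X]).natDegree = 1 := natDegree_X_add_C 1
    rw [this]; simp
  have := natDegree_mul_le (p := (X - 1 : ℝ[X]) ^ (2 * m)) (q := (X + 1 : ℝ[X]) ^ (2 * k - 2 * m))
  omega

lemma sum_even_odd (g : ℕ → ℝ) (k : ℕ) :
    ∑ d ∈ range (2 * k), g d = ∑ m ∈ range k, g (2 * m) + ∑ m ∈ range k, g (2 * m + 1) := by
  induction k with
  | zero => simp
  | succ k ih => rw [show 2 * (k + 1) = 2 * k + 1 + 1 by ring, sum_range_succ, sum_range_succ, ih,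
      sum_range_succ, sum_range_succ]; ring

lemma stab_eq (k : ℕ) (ρ : ℝ) : noiseStability (2 * k + 1) ρ (majorityF (2 * k + 1)) =
    ∑ m ∈ range (k + 1), WW k m * ρ ^ (2 * m + 1) := by
  rw [stab_fourier]
  let g : ℕ → ℝ := fun d => if Even d then 0 else ρ ^ d * (2 * cc k (d / 2)) ^ 2
  have h1 : ∀ S : Finset (Fin (2 * k + 1)),
      ρ ^ S.card * FF _ (majorityF (2 * k + 1)) S ^ 2 = g S.card := by
    intro S
    by_cases h : Even S.card
    · simp [g, h, FF_even k S h]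
    · obtain ⟨m, hm⟩ := Nat.not_even_iff_odd.1 h
      simp only [g, h, if_false]
      rw [FF_odd k m S hm, show S.card / 2 = m by omega]
  simp_rw [h1]
  rw [sum_powerset_apply_card g, card_univ, Fintype.card_fin, show 2 * k + 1 + 1 = 2 * (k + 1) by ring,
    sum_even_odd]
  have h2 : ∑ m ∈ range (k + 1), (2 * k + 1).choose (2 * m) • g (2 * m) = 0 :=
    sum_eq_zero fun m _ => by simp [g]
  rw [h2, zero_add, sum_div]
  refine sum_congr rfl fun m _ => ?_
  have h3 : g (2 * m + 1) = ρ ^ (2 * m + 1) * (2 * cc k m) ^ 2 := by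
    simp only [g]
    rw [if_neg (by simp), show (2 * m + 1) / 2 = m by omega]
  rw [h3, WW, nsmul_eq_mul, show (4 : ℝ) ^ (2 * k + 1) = 16 ^ k * 4 by rw [pow_succ, pow_mul]; norm_num]
  field_simp
  ring

lemma stab_one (k : ℕ) : noiseStability (2 * k + 1) 1 (majorityF (2 * k + 1)) = 1 := by
  unfold noiseStability
  have h1 : ∀ x y : Fin (2 * k + 1) → Bool, ∏ i, (if x i = y i then (1 + 1 : ℝ) / 2 else (1 - 1) / 2)
      = if x = y then 1 else 0 := by
    intro x y
    split_ifs with h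
    · subst h; simp
    · obtain ⟨i, hi⟩ := Function.ne_iff.1 h
      exact prod_eq_zero (mem_univ i) (by simp [hi])
  simp_rw [h1]
  have h2 : ∀ x : Fin (2 * k + 1) → Bool, majorityF (2 * k + 1) x * majorityF (2 * k + 1) x = 1 := by
    intro x; unfold majorityF; split_ifs <;> norm_num
  simp [h2]

/-- The noise stability of the majority functions on an odd number `2k+1` of bits
converges, as `k → ∞`, to `(2/π)·arcsin ρ`. -/
theorem noise_stability_majority (ρ : ℝ) (hρ0 : 0 ≤ ρ) (hρ1 : ρ ≤ 1) :
    Filter.Tendsto (fun k : ℕ => noiseStability (2 * k + 1) ρ (majorityF (2 * k + 1)))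
      Filter.atTop (nhds (2 / Real.pi * Real.arcsin ρ)) := by
  rcases hρ1.eq_or_lt with rfl | hlt
  · simp_rw [stab_one]
    rw [Real.arcsin_one, div_mul_div_comm, mul_comm, div_self (by positivity)]
    exact tendsto_const_nhds
  have hz : ∀ k m, k < m → WW k m = 0 := by
    intro k m h
    rw [WW, Nat.choose_eq_zero_of_lt (by omega)]; simp
  have hW1 : ∀ k m, WW k m ≤ 1 := by
    intro k m
    rcases lt_or_ge k m with h | h
    · rw [hz k m h]; exact zero_le_one
    · have := stab_eq k 1
      rw [stab_one] at this
      simp only [one_pow, mul_one] at this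
      rw [this]
      exact single_le_sum (f := fun m => WW k m) (fun i _ => WW_nonneg k i) (mem_range.2 (by omega))
  have hS : ∀ k, noiseStability (2 * k + 1) ρ (majorityF (2 * k + 1)) = ∑' m, WW k m * ρ ^ (2 * m + 1) := by
    intro k
    rw [stab_eq, tsum_eq_sum]
    intro m hm
    rw [hz k m (by simpa using hm), zero_mul]
  simp_rw [hS]
  rw [← arcsin_hasSum hρ0 hlt, ← tsum_mul_left]
  refine tendsto_tsum_of_dominated_convergence (bound := fun m : ℕ => ρ ^ (2 * m + 1)) ?_ ?_ ?_
  · simp_rw [pow_succ, pow_mul]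
    exact (summable_geometric_of_lt_one (by positivity) (by nlinarith)).mul_right _
  · intro m
    rw [← mul_assoc]
    refine (WW_tendsto (fun m => uu m / (2 * m + 1)) (by simp [uu]) ?_ m).mul_const _
    intro m
    rw [uu_succ]
    push_cast
    field_simp
    ring
  · refine Filter.Eventually.of_forall fun k m => ?_
    rw [Real.norm_of_nonneg (mul_nonneg (WW_nonneg k m) (by positivity))]
    have : 0 ≤ ρ ^ (2 * m + 1) := by positivity
    nlinarith [hW1 k m]
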